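/- Let L be a finite first-order language with only function symbols that contains a binary function symbol ∧, and let L₁, …, L_k be finite L-structures in each of which the interpretation of ∧ is a semilattice operation (idempotent, commutative, associative). Then there is an L-sentence φ of the form ∀x₁…∀x_p ∃y₁…∃y_q ∀z₁…∀z_r ψ, with ψ quantifier-free, such that for every finite L-structure A: A ⊨ φ if and only if there exist n ∈ ℕ, a function g : Fin n → Fin k, and an embedding of A into the direct product ∏_{j < n} L_{g(j)}. -/

import Mathlib

open FirstOrder Language

universe u v w

namespace Stmt15

variable {L : FirstOrder.Language.{v, w}} {α : Type*}

/-- The pointwise structure on a direct product of `L`-structures. -/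
instance piStructure {ι : Type*} {M : ι → Type*}
    [∀ i, L.Structure (M i)] : L.Structure (∀ i, M i) where
  funMap f x i := Structure.funMap f fun j => x j i
  RelMap r x := ∀ i, Structure.RelMap r fun j => x j i

/-- Existentially quantifies the last `k` bound variables of a bounded formula. -/
def exsN : ∀ {n k : ℕ}, L.BoundedFormula α (n + k) → L.BoundedFormula α n
  | _, 0, φ => φ
  | _, _ + 1, φ => exsN φ.ex

/-- Universally quantifies the last `k` bound variables of a bounded formula. -/
def allsN : ∀ {n k : ℕ}, L.BoundedFormula α (n + k) → L.BoundedFormula α n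
  | _, 0, φ => φ
  | _, _ + 1, φ => allsN φ.all

/-- A `∀*∃*∀*` sentence. -/
def IsAEASentence (Φ : L.Sentence) : Prop :=
  ∃ (p q r : ℕ) (ψ : L.BoundedFormula Empty (p + q + r)),
    ψ.IsQF ∧ Φ = (exsN (allsN ψ : L.BoundedFormula Empty (p + q)) :
      L.BoundedFormula Empty p).alls

/-- The interpretation of the binary function symbol `w` in `M` is a semilattice
operation: idempotent, commutative and associative. -/
def IsSemilatticeOp (w : L.Functions 2) (M : Type*) [L.Structure M] : Prop :=
  (∀ x : M, Structure.funMap w ![x, x] = x) ∧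
  (∀ x y : M, Structure.funMap w ![x, y] = Structure.funMap w ![y, x]) ∧
  (∀ x y z : M, Structure.funMap w ![x, Structure.funMap w ![y, z] ] =
    Structure.funMap w ![Structure.funMap w ![x, y], z])

section Helpers

theorem realize_exsN {M : Type*} [L.Structure M] {n k : ℕ} (φ : L.BoundedFormula α (n + k))
    (v : α → M) (xs : Fin n → M) :
    (exsN φ).Realize v xs ↔ ∃ ys : Fin k → M, φ.Realize v (Fin.append xs ys) := by
  induction k with
  | zero =>
    constructor
    · intro h
      exact ⟨Fin.elim0, by simpa [exsN, Fin.append_right_nil] using h⟩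
    · rintro ⟨ys, h⟩
      rw [Fin.append_right_nil _ _ rfl] at h
      simpa [exsN] using h
  | succ k ih =>
    have := ih (BoundedFormula.ex (n := n + k) φ)
    rw [exsN, this]
    constructor
    · rintro ⟨ys, h⟩
      rw [BoundedFormula.realize_ex] at h
      obtain ⟨a, h⟩ := h
      exact ⟨Fin.snoc ys a, by rw [Fin.append_snoc]; exact h⟩
    · rintro ⟨ys, h⟩
      refine ⟨Fin.init ys, ?_⟩
      rw [BoundedFormula.realize_ex]
      refine ⟨ys (Fin.last k), ?_⟩
      rw [← Fin.snoc_init_self ys, Fin.append_snoc] at h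
      exact h

theorem realize_allsN {M : Type*} [L.Structure M] {n k : ℕ} (φ : L.BoundedFormula α (n + k))
    (v : α → M) (xs : Fin n → M) :
    (allsN φ).Realize v xs ↔ ∀ ys : Fin k → M, φ.Realize v (Fin.append xs ys) := by
  induction k with
  | zero =>
    constructor
    · intro h ys
      rw [Fin.append_right_nil _ _ rfl]
      simpa [allsN] using h
    · intro h
      have h := h Fin.elim0
      rw [Fin.append_right_nil _ _ rfl] at h
      simpa [allsN] using h
  | succ k ih =>
    have := ih (BoundedFormula.all (n := n + k) φ)
    rw [allsN, this]
    constructor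
    · intro h ys
      have h := h (Fin.init ys)
      rw [BoundedFormula.realize_all] at h
      have h := h (ys (Fin.last k))
      rw [← Fin.snoc_init_self ys, Fin.append_snoc]
      exact h
    · intro h ys
      rw [BoundedFormula.realize_all]
      intro a
      have h := h (Fin.snoc ys a)
      rw [Fin.append_snoc] at h
      exact h

/-- Quantifier-free definability of a uniform family of predicates. -/
def QFDef (L : FirstOrder.Language.{v, w}) {V : Type*}
    (P : ∀ (A : Type u) [L.Structure A], (V → A) → Prop) : Prop :=
  ∃ ψ : L.Formula V, BoundedFormula.IsQF ψ ∧
    ∀ (A : Type u) [L.Structure A] (v : V → A), ψ.Realize v ↔ P A v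

theorem exists_AEA {X Y Z : Type*} [Finite X] [Finite Y] [Finite Z]
    (P : ∀ (A : Type u) [L.Structure A], (X ⊕ Y ⊕ Z → A) → Prop) (hP : QFDef L P) :
    ∃ φ : L.Sentence, IsAEASentence φ ∧ ∀ (A : Type u) [L.Structure A],
      (A ⊨ φ ↔ ∀ x : X → A, ∃ y : Y → A, ∀ z : Z → A, P A (Sum.elim x (Sum.elim y z))) := by
  obtain ⟨ψ, hψ, hr⟩ := hP
  let p := Nat.card X
  let q := Nat.card Y
  let r := Nat.card Z
  let ex : X ≃ Fin p := Finite.equivFin X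
  let ey : Y ≃ Fin q := Finite.equivFin Y
  let ez : Z ≃ Fin r := Finite.equivFin Z
  let g : X ⊕ Y ⊕ Z → Empty ⊕ Fin (p + q + r) := fun a => Sum.inr
    (Sum.elim (fun x => Fin.castAdd r (Fin.castAdd q (ex x)))
      (Sum.elim (fun y => Fin.castAdd r (Fin.natAdd p (ey y)))
        (fun z => Fin.natAdd (p + q) (ez z))) a)
  let ψ' : L.BoundedFormula Empty (p + q + r) := BoundedFormula.relabel (k := 0) g ψ
  refine ⟨_, ⟨p, q, r, ψ', hψ.relabel g, rfl⟩, ?_⟩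
  intro A _
  have key : ∀ (xs : Fin p → A) (ys : Fin q → A) (zs : Fin r → A) (e : Empty → A),
      ψ'.Realize e (Fin.append (Fin.append xs ys) zs) ↔
        P A (Sum.elim (xs ∘ ex) (Sum.elim (ys ∘ ey) (zs ∘ ez))) := by
    intro xs ys zs e
    rw [← hr]
    refine (BoundedFormula.realize_relabel (n := 0)).trans ?_
    unfold Formula.Realize
    refine iff_of_eq (congr_arg₂ _ ?_ (Subsingleton.elim _ _))
    funext a
    rcases a with a | a | a
    · change Fin.append (Fin.append xs ys) zs (Fin.castAdd r (Fin.castAdd q (ex a))) = _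
      simp
    · change Fin.append (Fin.append xs ys) zs (Fin.castAdd r (Fin.natAdd p (ey a))) = _
      simp
    · change Fin.append (Fin.append xs ys) zs (Fin.natAdd (p + q) (ez a)) = _
      simp
  unfold Sentence.Realize Formula.Realize
  refine BoundedFormula.realize_alls.trans ?_
  simp only [realize_exsN, realize_allsN, key]
  constructor
  · intro h x
    obtain ⟨ys, h⟩ := h (x ∘ ex.symm)
    refine ⟨ys ∘ ey, fun z => ?_⟩
    have := h (z ∘ ez.symm)
    simpa [Function.comp_assoc] using this
  · intro h xs
    obtain ⟨y, h⟩ := h (xs ∘ ex)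
    refine ⟨y ∘ ey.symm, fun zs => ?_⟩
    have := h (zs ∘ ez)
    simpa [Function.comp_assoc] using this

namespace QFDef

variable {V : Type*} {P Q : ∀ (A : Type u) [L.Structure A], (V → A) → Prop}

theorem congr (hP : QFDef L P) (h : ∀ (A : Type u) [L.Structure A] (v : V → A), P A v ↔ Q A v) :
    QFDef L Q := by
  obtain ⟨ψ, h1, h2⟩ := hP
  exact ⟨ψ, h1, fun A _ v => (h2 A v).trans (h A v)⟩

theorem eq (s t : L.Term V) : QFDef.{u} L (fun A _ v => s.realize v = t.realize v) :=
  ⟨s.equal t, (BoundedFormula.IsAtomic.equal _ _).isQF, fun A _ v => Formula.realize_equal⟩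

theorem const (c : Prop) : QFDef.{u} L (fun A _ (_ : V → A) => c) := by
  by_cases hc : c
  · exact ⟨⊤, BoundedFormula.IsQF.top, fun A _ v => by simp [hc, Formula.Realize]⟩
  · exact ⟨⊥, BoundedFormula.isQF_bot, fun A _ v => by simp [hc, Formula.Realize]⟩

theorem imp (hP : QFDef L P) (hQ : QFDef L Q) : QFDef L (fun A _ v => P A v → Q A v) := by
  obtain ⟨ψ, h1, h2⟩ := hP
  obtain ⟨χ, h3, h4⟩ := hQ
  exact ⟨ψ.imp χ, h1.imp h3, fun A _ v => by rw [Formula.realize_imp, h2, h4]⟩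

theorem not (hP : QFDef L P) : QFDef L (fun A _ v => ¬ P A v) :=
  (hP.imp (const False)).congr fun _ _ _ => Iff.rfl

theorem and (hP : QFDef L P) (hQ : QFDef L Q) : QFDef L (fun A _ v => P A v ∧ Q A v) :=
  (hP.imp hQ.not).not.congr fun _ _ _ => by tauto

theorem or (hP : QFDef L P) (hQ : QFDef L Q) : QFDef L (fun A _ v => P A v ∨ Q A v) :=
  (hP.not.imp hQ).congr fun _ _ _ => by tauto

theorem iff (hP : QFDef L P) (hQ : QFDef L Q) : QFDef L (fun A _ v => (P A v ↔ Q A v)) :=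
  ((hP.imp hQ).and (hQ.imp hP)).congr fun _ _ _ => by tauto

theorem all {ι : Type*} [Finite ι] {R : ι → ∀ (A : Type u) [L.Structure A], (V → A) → Prop}
    (h : ∀ i, QFDef L (R i)) : QFDef L (fun A _ v => ∀ i, R i A v) := by
  classical
  cases nonempty_fintype ι
  have : ∀ s : Finset ι, QFDef L (fun A _ v => ∀ i ∈ s, R i A v) := by
    intro s
    induction s using Finset.induction_on with
    | empty => exact (const True).congr fun _ _ _ => by simp
    | insert a s _ ih => exact ((h a).and ih).congr fun _ _ _ => by simp
  exact (this Finset.univ).congr fun _ _ _ => by simp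

theorem ex {ι : Type*} [Finite ι] {R : ι → ∀ (A : Type u) [L.Structure A], (V → A) → Prop}
    (h : ∀ i, QFDef L (R i)) : QFDef L (fun A _ v => ∃ i, R i A v) :=
  (all fun i => (h i).not).not.congr fun _ _ _ => by simp

end QFDef

/-- `c` is the value at `z` of the map coded by `S` and `y`. -/
def Val (w : L.Functions 2) {N : Type*} [L.Structure N] {A : Type*} [L.Structure A]
    (S : Set N) (y : N → A) (z : A) (c : N) : Prop :=
  ∀ c' : N, Structure.funMap w ![c', c] = c' ↔
    (c' ∈ S ∧ Structure.funMap w ![y c', z] = y c')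

theorem Val.unique {w : L.Functions 2} {N : Type*} [L.Structure N] {A : Type*} [L.Structure A]
    (hN : IsSemilatticeOp w N) {S : Set N} {y : N → A} {z : A} {c d : N}
    (hc : Val w S y z c) (hd : Val w S y z d) : c = d := by
  have h1 : Structure.funMap w ![c, d] = c := (hd c).2 ((hc c).1 (hN.1 c))
  have h2 : Structure.funMap w ![d, c] = d := (hc d).2 ((hd d).1 (hN.1 d))
  rw [← h1, hN.2.1, h2]

theorem qfDef_val {V : Type*} (w : L.Functions 2) {N : Type*} [L.Structure N] [Finite N]
    (S : Set N) (y : N → V) (t : L.Term V) (c : N) :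
    QFDef.{u} L (fun A _ v => Val w S (fun d => v (y d)) (t.realize v) c) := by
  refine QFDef.all fun c' => (QFDef.const _).iff ((QFDef.const _).and ?_)
  refine (QFDef.eq (w.apply₂ (Term.var (y c')) t) (Term.var (y c'))).congr fun A _ v => ?_
  simp [Term.realize_functions_apply₂]

/-- The homomorphism condition, separating `a` from `b`, tested at the tuple `z`. -/
def HomAt (w : L.Functions 2) {N : Type*} [L.Structure N] {A : Type*} [L.Structure A]
    (S : Set N) (y : N → A) (a b : A) (z : Unit ⊕ (Σ f : (Σ l, L.Functions l), Fin f.1) → A) :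
    Prop :=
  (∃ c, Val w S y (z (Sum.inl ())) c) ∧
  (∀ (f : Σ l, L.Functions l) (c : Fin f.1 → N), (∀ k, Val w S y (z (Sum.inr ⟨f, k⟩)) (c k)) →
    Val w S y (Structure.funMap f.2 fun k => z (Sum.inr ⟨f, k⟩)) (Structure.funMap f.2 c)) ∧
  ¬ ∃ c, Val w S y a c ∧ Val w S y b c

theorem qfDef_homAt {V : Type*} [Finite (Σ l, L.Functions l)]
    (w : L.Functions 2) {N : Type*} [L.Structure N] [Finite N]
    (S : Set N) (y : N → V) (a b : V) (z : Unit ⊕ (Σ f : (Σ l, L.Functions l), Fin f.1) → V) :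
    QFDef.{u} L (fun A _ v => HomAt w S (fun d => v (y d)) (v a) (v b) (fun i => v (z i))) := by
  refine (QFDef.ex fun c => qfDef_val w S y (Term.var _) c).and
    ((QFDef.all fun f => QFDef.all fun c => (QFDef.all fun k => ?_).imp ?_).and
      (QFDef.ex fun c => (qfDef_val w S y (Term.var _) c).and
        (qfDef_val w S y (Term.var _) c)).not)
  · exact qfDef_val w S y (Term.var _) (c k)
  · exact qfDef_val w S y (Term.func f.2 fun k => Term.var (z (Sum.inr ⟨f, k⟩))) _

theorem exists_hom {w : L.Functions 2} {N : Type*} [L.Structure N] {A : Type*} [L.Structure A]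
    (hN : IsSemilatticeOp w N) {S : Set N} {y : N → A} {a b : A}
    (h : ∀ z, HomAt w S y a b z) :
    ∃ F : A → N, (∀ (l : ℕ) (f : L.Functions l) (x : Fin l → A),
      F (Structure.funMap f x) = Structure.funMap f (F ∘ x)) ∧ F a ≠ F b := by
  have h1 : ∀ x : A, ∃ c, Val w S y x c := fun x => (h fun _ => x).1
  choose F hF using h1
  refine ⟨F, ?_, ?_⟩
  · intro l f x
    classical
    let z : Unit ⊕ (Σ f : (Σ l, L.Functions l), Fin f.1) → A := Sum.elim (fun _ => a)
      (fun s => if hs : s.1 = ⟨l, f⟩ then x (Fin.cast (by rw [hs]) s.2) else a)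
    have h2 := (h z).2.1 ⟨l, f⟩ (F ∘ x) (fun k => by simpa [z] using hF (x k))
    refine Val.unique hN (hF _) ?_
    simpa [z] using h2
  · intro hab
    exact (h fun _ => a).2.2 ⟨F a, hF a, hab ▸ hF b⟩

theorem exists_code {w : L.Functions 2} {N : Type*} [L.Structure N] {A : Type*} [L.Structure A]
    [Finite A] (hN : IsSemilatticeOp w N) (hA : IsSemilatticeOp w A) {a b : A}
    (F : A → N) (hF : ∀ (l : ℕ) (f : L.Functions l) (x : Fin l → A),
      F (Structure.funMap f x) = Structure.funMap f (F ∘ x)) (hab : F a ≠ F b) :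
    ∃ (S : Set N) (y : N → A), ∀ z, HomAt w S y a b z := by
  classical
  cases nonempty_fintype A
  have hF2 : ∀ x y, F (Structure.funMap w ![x, y]) = Structure.funMap w ![F x, F y] := by
    intro x y
    rw [hF]
    congr 1
    funext i
    fin_cases i <;> rfl
  let S : Set N := {c | ∃ x, Structure.funMap w ![c, F x] = c}
  have hmin : ∀ c, ∃ d : A, c ∈ S → Structure.funMap w ![c, F d] = c ∧
      ∀ x, Structure.funMap w ![c, F x] = c → Structure.funMap w ![d, x] = d := by
    intro c
    by_cases hc : c ∈ S
    swap
    · exact ⟨a, fun h => absurd h hc⟩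
    have : ∀ s : Finset A, ∃ d : A, Structure.funMap w ![c, F d] = c ∧
      ∀ x ∈ s, Structure.funMap w ![c, F x] = c → Structure.funMap w ![d, x] = d := by
      intro s
      induction s using Finset.induction_on with
      | empty =>
        obtain ⟨x, hx⟩ := hc
        exact ⟨x, hx, by simp⟩
      | insert x s _ ih =>
        obtain ⟨d, hd1, hd2⟩ := ih
        by_cases hx : Structure.funMap w ![c, F x] = c
        · refine ⟨Structure.funMap w ![x, d], ?_, ?_⟩
          · rw [hF2, hN.2.2, hx, hd1]
          · intro t ht hct
            rcases Finset.mem_insert.1 ht with rfl | ht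
            · rw [hA.2.1 t d, ← hA.2.2, hA.1]
            · rw [← hA.2.2, hd2 t ht hct]
        · refine ⟨d, hd1, ?_⟩
          intro t ht hct
          rcases Finset.mem_insert.1 ht with rfl | ht
          · exact absurd hct hx
          · exact hd2 t ht hct
    obtain ⟨d, h1, h2⟩ := this Finset.univ
    exact ⟨d, fun _ => ⟨h1, fun x => h2 x (Finset.mem_univ x)⟩⟩
  choose y hy using hmin
  have hval : ∀ x, Val w S y x (F x) := by
    intro x c
    constructor
    · intro h
      have hc : c ∈ S := ⟨x, h⟩
      exact ⟨hc, (hy c hc).2 x h⟩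
    · rintro ⟨hc, h⟩
      have h1 := (hy c hc).1
      have h2 := congrArg F h
      rw [hF2] at h2
      rw [← h1, ← hN.2.2, h2]
  refine ⟨S, y, fun z => ⟨⟨_, hval _⟩, ?_, ?_⟩⟩
  · intro f c hc
    have : c = F ∘ fun k => z (Sum.inr ⟨f, k⟩) := by
      funext k
      exact Val.unique hN (hc k) (hval _)
    rw [this, ← hF]
    exact hval _
  · rintro ⟨c, h1, h2⟩
    exact hab ((Val.unique hN (hval a) h1).trans (Val.unique hN h2 (hval b)))

theorem semilattice_of_embedding {w : L.Functions 2} {ι : Type*} {M : ι → Type*}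
    [∀ i, L.Structure (M i)] (hM : ∀ i, IsSemilatticeOp w (M i)) {A : Type*} [L.Structure A]
    (e : A ↪[L] (∀ i, M i)) : IsSemilatticeOp w A := by
  have h2 : ∀ x y i, e (Structure.funMap w ![x, y]) i = Structure.funMap w ![e x i, e y i] := by
    intro x y i
    rw [e.map_fun]
    change Structure.funMap w _ = _
    congr 1
    funext j
    fin_cases j <;> rfl
  refine ⟨fun x => ?_, fun x y => ?_, fun x y z => ?_⟩ <;> apply e.injective <;> funext i <;>
    simp only [h2]
  · exact (hM i).1 _
  · exact (hM i).2.1 _ _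
  · exact (hM i).2.2 _ _ _

end Helpers

theorem stmt15 (L : FirstOrder.Language.{v, w}) [L.IsAlgebraic] [Finite L.Symbols]
    (w : L.Functions 2) (k : ℕ) (Ls : Fin k → Type u) (iL : ∀ i, L.Structure (Ls i))
    (hLfin : ∀ i, Finite (Ls i)) (hsemi : ∀ i, IsSemilatticeOp w (Ls i)) :
    ∃ φ : L.Sentence, IsAEASentence φ ∧
      ∀ (A : Type u) [L.Structure A], Finite A →
        (A ⊨ φ ↔ ∃ (n : ℕ) (g : Fin n → Fin k),
          Nonempty (A ↪[L] (∀ j : Fin n, Ls (g j)))) := by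
  classical
  have : Finite (Σ l, L.Functions l) :=
    Finite.of_injective (β := L.Symbols) (fun f => Sum.inl f) Sum.inl_injective
  let J := Σ i, Set (Ls i)
  let C := Σ i, Ls i
  let Z := Unit ⊕ (Σ f : (Σ l, L.Functions l), Fin f.1)
  obtain ⟨φ, hφ, hr⟩ := exists_AEA (L := L) (X := Bool) (Y := J ⊕ C) (Z := Z)
    (fun A _ v => v (Sum.inl true) = v (Sum.inl false) ∨
      ((∃ j : J, v (Sum.inr (Sum.inl (Sum.inl j))) = v (Sum.inl true)) ∧
        ∀ j : J, v (Sum.inr (Sum.inl (Sum.inl j))) = v (Sum.inl true) →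
          HomAt w j.2 (fun d => v (Sum.inr (Sum.inl (Sum.inr ⟨j.1, d⟩))))
            (v (Sum.inl true)) (v (Sum.inl false)) (fun z => v (Sum.inr (Sum.inr z)))))
    (by
      have hv : ∀ s t : Bool ⊕ (J ⊕ C) ⊕ Z, QFDef.{u} L (fun A _ v => v s = v t) :=
        fun s t => QFDef.eq (Term.var s) (Term.var t)
      refine (hv _ _).or ((QFDef.ex fun j => hv _ _).and (QFDef.all fun j => (hv _ _).imp ?_))
      exact qfDef_homAt (V := Bool ⊕ (J ⊕ C) ⊕ Z) w j.2 (fun d => Sum.inr (Sum.inl (Sum.inr ⟨j.1, d⟩))) (Sum.inl true)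
        (Sum.inl false) (fun z => Sum.inr (Sum.inr z)))
  refine ⟨φ, hφ, ?_⟩
  intro A _ hA
  rw [hr]
  simp only [Sum.elim_inl, Sum.elim_inr]
  constructor
  · intro h
    let D := {ab : A × A // ab.1 ≠ ab.2}
    have hsep : ∀ d : D, ∃ (i : Fin k) (F : A → Ls i),
        (∀ (l : ℕ) (f : L.Functions l) (x : Fin l → A),
          F (Structure.funMap f x) = Structure.funMap f (F ∘ x)) ∧ F d.1.1 ≠ F d.1.2 := by
      rintro ⟨⟨a, b⟩, hab⟩
      obtain ⟨y, h⟩ := h (fun t => cond t a b)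
      have h' := fun z => (h z).resolve_left hab
      obtain ⟨j, hj⟩ := (h' fun _ => a).1
      exact ⟨j.1, exists_hom (hsemi j.1) fun z => (h' z).2 j hj⟩
    choose i F hF hs using hsep
    let e : D ≃ Fin (Nat.card D) := Finite.equivFin D
    refine ⟨Nat.card D, fun j => i (e.symm j), ⟨⟨⟨fun x j => F (e.symm j) x, ?_⟩, ?_, ?_⟩⟩⟩
    · intro a b hab
      by_contra hne
      have := congrFun hab (e ⟨(a, b), hne⟩)
      simp only at this
      rw [Equiv.symm_apply_apply] at this
      exact hs _ this
    · intro l f x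
      funext j
      exact hF _ l f x
    · intro l r
      exact isEmptyElim r
  · rintro ⟨n, g, ⟨e⟩⟩ x
    by_cases hx : x true = x false
    · exact ⟨fun _ => x true, fun _ => Or.inl hx⟩
    have hsA := semilattice_of_embedding (fun i => hsemi (g i)) e
    obtain ⟨j, hj⟩ : ∃ j, e (x true) j ≠ e (x false) j := by
      by_contra hcon
      push Not at hcon
      exact hx (e.injective (funext hcon))
    obtain ⟨S, y, hS⟩ := exists_code (hsemi (g j)) hsA (fun a => e a j) (fun l f t => by
      simp only [e.map_fun]
      rfl) hj
    refine ⟨Sum.elim (fun t => if t = ⟨g j, S⟩ then x true else x false)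
      (fun c => if hc : c.1 = g j then y (hc ▸ c.2) else x true), fun z => Or.inr ⟨?_, ?_⟩⟩
    · exact ⟨⟨g j, S⟩, by simp⟩
    · intro t ht
      have : t = ⟨g j, S⟩ := by
        by_contra hne
        simp only [Sum.elim_inl, if_neg hne] at ht
        exact hx ht.symm
      subst this
      simpa using hS z

end Stmt15
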